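/- arXiv:2111.02191 — 3 statements merged into one kernel-verified Lean document; each statement's English description precedes it below -/
import Mathlib

section
/- Let K = diag(K₁,…,K_d) where each K_i : [0,T] → ℝ is integrable, and suppose ψ : [0,T] → ℝ^{1×d} is continuous and satisfies ψ(t) = ∫₀ᵗ F₁(ψ(t−s)) K(s) ds for all t ∈ [0,T]. Then φ := c·ψ is continuous and satisfies φ(t) = ∫₀ᵗ F₂(φ(t−s)) K(s) ds for all t ∈ [0,T], where c = (1−γ)/(1−γ+γρ²). -/
open Matrix MeasureTheory

attribute [local instance] Matrix.normedAddCommGroup Matrix.normedSpace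

/-- If ψ is a continuous solution of the Riccati–Volterra equation with
nonlinearity F₁, then φ := c·ψ is a continuous solution of the corresponding equation
with nonlinearity F₂, where c = (1−γ)/(1−γ+γρ²). -/
theorem stmt_1 (d : ℕ) (hd : 1 ≤ d) (γ ρ : ℝ)
    (hγ : γ ∈ Set.Ioo (0 : ℝ) 1) (hρ : ρ ∈ Set.Icc (-1 : ℝ) 1)
    (c : ℝ) (hc : c = (1 - γ) / (1 - γ + γ * ρ ^ 2))
    (θ : Matrix (Fin 1) (Fin d) ℝ) (ν : Fin d → ℝ)
    (Λ : Matrix (Fin d) (Fin d) ℝ)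
    (N Θ P : Matrix (Fin d) (Fin d) ℝ)
    (hN : N = Matrix.diagonal ν)
    (hΘ : Θ = Matrix.diagonal fun i => θ 0 i)
    (hP : P = ρ • (1 : Matrix (Fin d) (Fin d) ℝ))
    (F₁ F₂ : Matrix (Fin 1) (Fin d) ℝ → Matrix (Fin 1) (Fin d) ℝ)
    (hF₁ : ∀ ψ : Matrix (Fin 1) (Fin d) ℝ,
      F₁ ψ = (γ / (2 * c * (1 - γ))) • (θ * Θ) + ψ * Λ
        + (1 / 2 : ℝ) • (ψ * N ^ 2 * Matrix.diagonal fun i => ψ 0 i))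
    (hF₂ : ∀ ψ : Matrix (Fin 1) (Fin d) ℝ,
      F₂ ψ = (γ / (2 * (1 - γ))) • (θ * Θ) + ψ * Λ
        + (1 / 2 : ℝ) • ((ψ * N ^ 2 * Matrix.diagonal fun i => ψ 0 i)
          + (γ / (1 - γ)) • (ψ * N ^ 2 * P ^ 2 * Matrix.diagonal fun i => ψ 0 i)))
    (T : ℝ) (hT : 0 < T)
    (Kf : Fin d → ℝ → ℝ)
    (hKf : ∀ i, IntegrableOn (Kf i) (Set.Icc 0 T))
    (K : ℝ → Matrix (Fin d) (Fin d) ℝ)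
    (hK : ∀ s, K s = Matrix.diagonal fun i => Kf i s)
    (ψ : ℝ → Matrix (Fin 1) (Fin d) ℝ)
    (hψc : ContinuousOn ψ (Set.Icc 0 T))
    (hψ : ∀ t ∈ Set.Icc (0 : ℝ) T,
      ψ t = ∫ s in (0 : ℝ)..t, F₁ (ψ (t - s)) * K s) :
    ContinuousOn (fun t => c • ψ t) (Set.Icc 0 T) ∧
      ∀ t ∈ Set.Icc (0 : ℝ) T,
        c • ψ t = ∫ s in (0 : ℝ)..t, F₂ (c • ψ (t - s)) * K s := by
  obtain ⟨hγ0, hγ1⟩ := hγ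
  have h1γ : 0 < 1 - γ := sub_pos.mpr hγ1
  have hden : 0 < 1 - γ + γ * ρ ^ 2 := by positivity
  have hc0 : c ≠ 0 := hc ▸ (div_pos h1γ hden).ne'
  have hP2 : P ^ 2 = ρ ^ 2 • (1 : Matrix (Fin d) (Fin d) ℝ) := by
    rw [hP, smul_pow, one_pow]
  have hconst : c * (γ / (2 * c * (1 - γ))) = γ / (2 * (1 - γ)) := by
    field_simp
  have hquad : c * (1 + γ / (1 - γ) * ρ ^ 2) = 1 := by
    rw [hc]
    field_simp
  have hF : ∀ x, F₂ (c • x) = c • F₁ x := by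
    intro x
    have hdiag : (Matrix.diagonal fun i => (c • x) 0 i)
        = c • Matrix.diagonal fun i => x 0 i := by
      rw [← Matrix.diagonal_smul]
      rfl
    rw [hF₁, hF₂, hdiag, hP2, ← hconst]
    simp only [Matrix.smul_mul, Matrix.mul_smul, Matrix.mul_one, smul_add, smul_smul]
    rw [← add_smul]
    congr 2
    linear_combination (c / 2) * hquad
  refine ⟨hψc.const_smul c, fun t ht => ?_⟩
  simp only [hF, Matrix.smul_mul]
  rw [intervalIntegral.integral_smul, ← hψ t ht]
end

section
/- Assume each kernel K_i is completely monotone on (0,∞) and locally square-integrable, and assume that for every 1 ≤ i ≤ d one has δ_i + (γ/(1−γ))ν_iρ_iθ_i < 0 and (δ_i + (γ/(1−γ))ν_iρ_iθ_i)² − (γ/(1−γ))·((1−γ+γρ_i²)/(1−γ))·ν_i²θ_i² > 0. Then there exists a unique continuous global solution ψ : [0,∞) → ℝ^{1×d} of the Riccati–Volterra equation ψ(t) = ∫₀ᵗ F₂(ψ(t−s)) K(s) ds for all t ≥ 0. -/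
open Matrix MeasureTheory

attribute [local instance] Matrix.normedAddCommGroup Matrix.normedSpace

section

open Set Filter

theorem quad_root {a b c : ℝ} (ha : 0 ≤ a) (hb : b < 0) (hc : 0 ≤ c) (h : 0 < b ^ 2 - 4 * a * c) :
    ∃ r, 0 ≤ r ∧ a + b * r + c * r ^ 2 = 0 ∧ ∀ x, x ≤ r → 0 ≤ a + b * x + c * x ^ 2 := by
  set s := √(b ^ 2 - 4 * a * c)
  have hs2 : s ^ 2 = b ^ 2 - 4 * a * c := Real.sq_sqrt h.le
  have hs0 : 0 < s := Real.sqrt_pos.2 h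
  have hsb : 0 < s - b := by linarith
  have hr : 2 * a / (s - b) * (s - b) = 2 * a := by field_simp
  have hr0 : 0 ≤ 2 * a / (s - b) := by positivity
  set r := 2 * a / (s - b)
  have hcr : 2 * c * r = -(b + s) := by
    refine mul_right_cancel₀ hsb.ne' ?_
    linear_combination 2 * c * hr + hs2
  have hroot : a + b * r + c * r ^ 2 = 0 := by linear_combination r / 2 * hcr - hr / 2
  refine ⟨r, hr0, hroot, fun x hx => ?_⟩
  have : a + b * x + c * x ^ 2 = (r - x) * (s + c * (r - x)) := by
    linear_combination hroot + (x - r) * hcr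
  rw [this]
  have := sub_nonneg.2 hx
  positivity

theorem exists_exp_weight {k : ℝ → ℝ} (hk0 : ∀ t > 0, 0 ≤ k t) (hk : AntitoneOn k (Ioi 0))
    (hki_loc : ∀ T > (0 : ℝ), IntegrableOn k (Ioc 0 T)) {ε : ℝ} (hε : 0 < ε) :
    ∃ l : ℝ, 0 ≤ l ∧ IntegrableOn (fun s => Real.exp (-l * s) * k s) (Ioi 0) ∧
      ∫ s in Ioi 0, Real.exp (-l * s) * k s < ε := by
  have hm : AEStronglyMeasurable k (volume.restrict (Ioi 0)) :=
    (aemeasurable_restrict_of_antitoneOn measurableSet_Ioi hk).aestronglyMeasurable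
  have hmn : ∀ l : ℝ, AEStronglyMeasurable (fun s => Real.exp (-l * s) * k s)
      (volume.restrict (Ioi 0)) := fun l =>
    (by fun_prop : Continuous fun s : ℝ => Real.exp (-l * s)).aestronglyMeasurable.mul hm
  have h1 : IntegrableOn (fun s => Real.exp (-1 * s) * k s) (Ioi 0) := by
    rw [← Ioc_union_Ioi_eq_Ioi (zero_le_one' ℝ)]
    refine IntegrableOn.union ?_ ?_
    · refine Integrable.mono' (hki_loc 1 one_pos)
        ((hmn 1).mono_measure (Measure.restrict_mono Ioc_subset_Ioi_self le_rfl)) ?_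
      filter_upwards [ae_restrict_mem measurableSet_Ioc] with s hs
      rw [Real.norm_of_nonneg (mul_nonneg (Real.exp_pos _).le (hk0 s hs.1))]
      exact mul_le_of_le_one_left (hk0 s hs.1) (Real.exp_le_one_iff.2 (by linarith [hs.1]))
    · refine Integrable.mono' ((integrableOn_exp_mul_Ioi (a := -1) (by norm_num) 1).mul_const (k 1))
        ((hmn 1).mono_measure (Measure.restrict_mono (Ioi_subset_Ioi zero_le_one) le_rfl)) ?_
      filter_upwards [ae_restrict_mem measurableSet_Ioi] with s hs
      have hs0 : (0 : ℝ) < s := one_pos.trans hs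
      rw [Real.norm_of_nonneg (mul_nonneg (Real.exp_pos _).le (hk0 s hs0))]
      gcongr
      exact hk (mem_Ioi.2 one_pos) hs0 (le_of_lt hs)
  have hle : ∀ n : ℕ, ∀ᵐ s ∂(volume.restrict (Ioi (0 : ℝ))),
      ‖Real.exp (-(n + 1 : ℝ) * s) * k s‖ ≤ Real.exp (-1 * s) * k s := by
    intro n
    filter_upwards [ae_restrict_mem measurableSet_Ioi] with s hs
    have hs : 0 < s := hs
    rw [Real.norm_of_nonneg (mul_nonneg (Real.exp_pos _).le (hk0 s hs))]
    refine mul_le_mul_of_nonneg_right (Real.exp_le_exp.2 ?_) (hk0 s hs)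
    have : 0 ≤ (n : ℝ) * s := by positivity
    linarith
  have hlim : Tendsto (fun n : ℕ => ∫ s in Ioi 0, Real.exp (-(n + 1 : ℝ) * s) * k s) atTop
      (nhds (∫ s in Ioi (0 : ℝ), (0 : ℝ))) := by
    refine tendsto_integral_of_dominated_convergence _ (fun n => hmn (n + 1)) h1 hle ?_
    filter_upwards [ae_restrict_mem measurableSet_Ioi] with s hs
    have hs : 0 < s := hs
    have : Tendsto (fun n : ℕ => Real.exp (-((n + 1 : ℝ) * s))) atTop (nhds 0) :=
      Real.tendsto_exp_neg_atTop_nhds_zero.comp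
        ((tendsto_atTop_add_const_right _ _ tendsto_natCast_atTop_atTop).atTop_mul_const hs)
    simpa only [neg_mul, zero_mul] using this.mul_const (k s)
  rw [integral_zero] at hlim
  obtain ⟨n, hn⟩ := (hlim.eventually (gt_mem_nhds hε)).exists
  exact ⟨n + 1, by positivity, Integrable.mono' h1 (hmn _) (hle n), hn⟩

theorem intervalIntegrable_of_integrableOn_Ioc {k : ℝ → ℝ}
    (hki_loc : ∀ T > (0 : ℝ), IntegrableOn k (Ioc 0 T)) {t : ℝ} (ht : 0 ≤ t) :
    IntervalIntegrable k volume 0 t := by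
  rw [intervalIntegrable_iff_integrableOn_Ioc_of_le ht]
  rcases ht.eq_or_lt with h | h
  · simp [← h]
  · exact hki_loc t h

theorem IntervalIntegrable.convolution_integrand {k f : ℝ → ℝ} {t : ℝ} (ht : 0 ≤ t)
    (hki_loc : IntervalIntegrable k volume 0 t) (hf : ContinuousOn f (Ici 0)) :
    IntervalIntegrable (fun s => f (t - s) * k s) volume 0 t := by
  refine hki_loc.continuousOn_mul (hf.comp (by fun_prop) fun s hs => ?_)
  rw [uIcc_of_le ht] at hs
  exact sub_nonneg.2 hs.2

theorem volterra_unique {k F : ℝ → ℝ} (hk0 : ∀ t > 0, 0 ≤ k t) (hk : AntitoneOn k (Ioi 0))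
    (hki_loc : ∀ T > (0 : ℝ), IntegrableOn k (Ioc 0 T)) (hF : LocallyLipschitz F) {φ ψ : ℝ → ℝ}
    (hφ : ContinuousOn φ (Ici 0)) (hψ : ContinuousOn ψ (Ici 0))
    (hφe : ∀ t ≥ (0 : ℝ), φ t = ∫ s in (0 : ℝ)..t, F (φ (t - s)) * k s)
    (hψe : ∀ t ≥ (0 : ℝ), ψ t = ∫ s in (0 : ℝ)..t, F (ψ (t - s)) * k s) :
    ∀ t ≥ (0 : ℝ), φ t = ψ t := by
  intro T hT
  have hφT := hφ.mono (Icc_subset_Ici_self : Icc 0 T ⊆ Ici 0)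
  have hψT := hψ.mono (Icc_subset_Ici_self : Icc 0 T ⊆ Ici 0)
  obtain ⟨L, hL⟩ := (hF.locallyLipschitzOn
    (s := φ '' Icc 0 T ∪ ψ '' Icc 0 T)).exists_lipschitzOnWith_of_compact
    ((isCompact_Icc.image_of_continuousOn hφT).union (isCompact_Icc.image_of_continuousOn hψT))
  have hL1 : 0 < (L : ℝ) + 1 := by positivity
  obtain ⟨l, -, hl, hlε⟩ := exists_exp_weight hk0 hk hki_loc (inv_pos.2 hL1)
  obtain ⟨t, ht, htmax⟩ := isCompact_Icc.exists_isMaxOn (nonempty_Icc.2 hT)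
    (f := fun t => Real.exp (-l * t) * |φ t - ψ t|)
    ((by fun_prop : Continuous fun t : ℝ => Real.exp (-l * t)).continuousOn.mul (hφT.sub hψT).abs)
  set m := Real.exp (-l * t) * |φ t - ψ t|
  have hm0 : 0 ≤ m := by positivity
  have hbd : ∀ r ∈ Icc 0 T, |φ r - ψ r| ≤ Real.exp (l * r) * m := fun r hr => by
    have h := mul_le_mul_of_nonneg_left (htmax hr : _ ≤ m) (Real.exp_pos (l * r)).le
    rwa [← mul_assoc, ← Real.exp_add, neg_mul, add_neg_cancel, Real.exp_zero, one_mul] at h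
  have hsub : Ioc 0 t ⊆ Ioi 0 := Ioc_subset_Ioi_self
  have hki : IntervalIntegrable k volume 0 t :=
    intervalIntegrable_of_integrableOn_Ioc hki_loc ht.1
  have hlint : ∫ s in (0 : ℝ)..t, Real.exp (-l * s) * k s ≤ (L + 1 : ℝ)⁻¹ := by
    rw [intervalIntegral.integral_of_le ht.1]
    refine le_trans (setIntegral_mono_set hl ?_ hsub.eventuallyLE) hlε.le
    filter_upwards [ae_restrict_mem measurableSet_Ioi] with s hs
    exact mul_nonneg (Real.exp_pos _).le (hk0 s hs)
  have key : |φ t - ψ t| ≤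
      ∫ s in (0 : ℝ)..t, (L * m * Real.exp (l * t)) * (Real.exp (-l * s) * k s) := by
    rw [← Real.norm_eq_abs, hφe t ht.1, hψe t ht.1, ← intervalIntegral.integral_sub
      (hki.convolution_integrand (f := fun r => F (φ r)) ht.1
        (hF.continuous.comp_continuousOn hφ))
      (hki.convolution_integrand (f := fun r => F (ψ r)) ht.1
        (hF.continuous.comp_continuousOn hψ))]
    refine intervalIntegral.norm_integral_le_of_norm_le ht.1 ?_
      (((intervalIntegrable_iff_integrableOn_Ioc_of_le ht.1).2 (hl.mono_set hsub)).const_mul _)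
    refine Eventually.of_forall fun s hs => ?_
    have hts : t - s ∈ Icc 0 T := ⟨sub_nonneg.2 hs.2, by linarith [hs.1, ht.2]⟩
    have h1 := hL.dist_le_mul _ (Or.inl (mem_image_of_mem φ hts)) _
      (Or.inr (mem_image_of_mem ψ hts))
    rw [← sub_mul, norm_mul, Real.norm_of_nonneg (hk0 s hs.1)]
    have h2 : Real.exp (l * t) * Real.exp (-l * s) = Real.exp (l * (t - s)) := by
      rw [← Real.exp_add]; ring_nf
    calc _ ≤ L * (Real.exp (l * (t - s)) * m) * k s :=
          mul_le_mul_of_nonneg_right (h1.trans (mul_le_mul_of_nonneg_left (hbd _ hts) L.2))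
            (hk0 s hs.1)
      _ = _ := by rw [← h2]; ring
  rw [intervalIntegral.integral_const_mul] at key
  have h3 : m ≤ L * m * (L + 1 : ℝ)⁻¹ := by
    have h4 := key.trans (mul_le_mul_of_nonneg_left hlint (by positivity))
    have h5 : Real.exp (-l * t) * Real.exp (l * t) = 1 := by
      rw [← Real.exp_add, neg_mul, neg_add_cancel, Real.exp_zero]
    calc m ≤ Real.exp (-l * t) * (L * m * Real.exp (l * t) * (L + 1 : ℝ)⁻¹) :=
          mul_le_mul_of_nonneg_left h4 (Real.exp_pos _).le
      _ = _ := by linear_combination (L * m * (L + 1 : ℝ)⁻¹) * h5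
  have h6 : m ≤ 0 := by
    rw [← div_eq_mul_inv, le_div_iff₀ hL1] at h3
    linarith
  have h7 := (hbd T (right_mem_Icc.2 hT)).trans
    (mul_nonpos_of_nonneg_of_nonpos (Real.exp_pos _).le h6)
  exact sub_eq_zero.1 (abs_nonpos_iff.1 h7)

/-- The convolution of an integrable function with the restriction to `[0, ∞)` of a bounded
continuous function is continuous. -/
theorem continuous_integral_mul_indicator_Ici {κ g : ℝ → ℝ} {B : ℝ} (hκ : Integrable κ)
    (hg : Continuous g) (hB : ∀ r ≥ 0, |g r| ≤ B) :
    Continuous fun t => ∫ s, (Ici 0).indicator g (t - s) * κ s := by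
  have hB0 : 0 ≤ B := (abs_nonneg _).trans (hB 0 le_rfl)
  rw [continuous_iff_continuousAt]
  intro t
  refine continuousAt_of_dominated (bound := fun s => B * ‖κ s‖)
    (Eventually.of_forall fun x => ?_) (Eventually.of_forall fun x => ?_) (hκ.norm.const_mul B) ?_
  · exact ((hg.measurable.indicator measurableSet_Ici).comp
      (measurable_const.sub measurable_id)).aestronglyMeasurable.mul hκ.aestronglyMeasurable
  · refine Eventually.of_forall fun s => ?_
    rw [norm_mul]
    refine mul_le_mul_of_nonneg_right ?_ (norm_nonneg _)
    rw [norm_indicator_eq_indicator_norm]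
    exact indicator_le' (fun r hr => hB r hr) (fun _ _ => hB0) _
  · filter_upwards [Measure.ae_ne volume t] with s hs
    refine ContinuousAt.mul ?_ continuousAt_const
    have h : ContinuousAt ((Ici (0 : ℝ)).indicator g) (t - s) := by
      refine hg.continuousOn.continuousAt_indicator ?_
      simpa [frontier_Ici, sub_eq_zero] using hs.symm
    exact ContinuousAt.comp (f := fun x => x - s) h (by fun_prop)

theorem volterra_exists {k F : ℝ → ℝ} (hk0 : ∀ t > 0, 0 ≤ k t) (hk : AntitoneOn k (Ioi 0))
    (hki_loc : ∀ T > (0 : ℝ), IntegrableOn k (Ioc 0 T)) {L : NNReal} (hF : LipschitzWith L F)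
    {B : ℝ} (hB : ∀ x, |F x| ≤ B) :
    ∃ ψ : ℝ → ℝ, Continuous ψ ∧ ∀ t ≥ (0 : ℝ), ψ t = ∫ s in (0 : ℝ)..t, F (ψ (t - s)) * k s := by
  have hL1 : 0 < (L : ℝ) + 1 := by positivity
  obtain ⟨l, hl0, hl, hlε⟩ := exists_exp_weight hk0 hk hki_loc (inv_pos.2 hL1)
  set κ : ℝ → ℝ := (Ioi 0).indicator fun s => Real.exp (-l * s) * k s with hκdef
  have hκ : Integrable κ := (integrable_indicator_iff measurableSet_Ioi).2 hl
  have hκ0 : ∀ s, 0 ≤ κ s := indicator_nonneg fun s hs => mul_nonneg (Real.exp_pos _).le (hk0 s hs)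
  have hκε : ∫ s, κ s < (L + 1 : ℝ)⁻¹ := by rwa [integral_indicator measurableSet_Ioi]
  let g : BoundedContinuousFunction ℝ ℝ → ℝ → ℝ :=
    fun v r => Real.exp (-l * r) * F (Real.exp (l * r) * v r)
  have hgc : ∀ v, Continuous (g v) := fun v => by
    have := hF.continuous
    fun_prop
  have hgB : ∀ v, ∀ r ≥ 0, |g v r| ≤ B := fun v r hr => by
    rw [abs_mul, abs_of_pos (Real.exp_pos _)]
    exact (mul_le_of_le_one_left (abs_nonneg _)
      (Real.exp_le_one_iff.2 (by rw [neg_mul]; exact neg_nonpos.2 (mul_nonneg hl0 hr)))).trans (hB _)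
  have hB0 : 0 ≤ B := (abs_nonneg _).trans (hB 0)
  have hgi : ∀ v r, ‖(Ici 0).indicator (g v) r‖ ≤ B := fun v r => by
    rw [norm_indicator_eq_indicator_norm]
    exact indicator_le' (fun r hr => hgB v r hr) (fun _ _ => hB0) _
  have hΦint : ∀ v t, Integrable fun s => (Ici 0).indicator (g v) (t - s) * κ s := fun v t =>
    hκ.bdd_mul (c := B) (((hgc v).measurable.indicator measurableSet_Ici).comp
      (measurable_const.sub measurable_id)).aestronglyMeasurable
      (Eventually.of_forall fun s => hgi v _)
  let Φ : BoundedContinuousFunction ℝ ℝ → BoundedContinuousFunction ℝ ℝ := fun v =>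
    BoundedContinuousFunction.ofNormedAddCommGroup
      (fun t => ∫ s, (Ici 0).indicator (g v) (t - s) * κ s)
      (continuous_integral_mul_indicator_Ici hκ (hgc v) (hgB v)) (∫ s, B * κ s) fun t =>
        norm_integral_le_of_norm_le (hκ.const_mul B) <| Eventually.of_forall fun s => by
          rw [norm_mul, Real.norm_of_nonneg (hκ0 s)]
          exact mul_le_mul_of_nonneg_right (hgi v _) (hκ0 s)
  have hgL : ∀ v w r, |(Ici 0).indicator (g v) r - (Ici 0).indicator (g w) r| ≤ L * dist v w := by
    intro v w r
    by_cases hr : r ∈ Ici (0 : ℝ)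
    · rw [indicator_of_mem hr, indicator_of_mem hr, ← mul_sub, abs_mul, abs_of_pos (Real.exp_pos _)]
      have h1 := hF.dist_le_mul (Real.exp (l * r) * v r) (Real.exp (l * r) * w r)
      rw [Real.dist_eq, Real.dist_eq, ← mul_sub, abs_mul, abs_of_pos (Real.exp_pos _)] at h1
      have h2 := v.dist_coe_le_dist (g := w) r
      rw [Real.dist_eq] at h2
      have h5 : Real.exp (-l * r) * Real.exp (l * r) = 1 := by
        rw [← Real.exp_add, neg_mul, neg_add_cancel, Real.exp_zero]
      calc _ ≤ Real.exp (-l * r) * (L * (Real.exp (l * r) * |v r - w r|)) :=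
            mul_le_mul_of_nonneg_left h1 (Real.exp_pos _).le
        _ = L * |v r - w r| := by linear_combination (L * |v r - w r|) * h5
        _ ≤ _ := mul_le_mul_of_nonneg_left h2 L.2
    · rw [indicator_of_notMem hr, indicator_of_notMem hr, sub_zero, abs_zero]
      positivity
  have hΦ : ContractingWith (L * (L + 1)⁻¹) Φ := by
    refine ⟨?_, LipschitzWith.of_dist_le_mul fun v w => ?_⟩
    · rw [← div_eq_mul_inv, div_lt_one (by positivity)]
      exact lt_add_one L
    · refine (BoundedContinuousFunction.dist_le (by positivity)).2 fun t => ?_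
      change dist (∫ s, (Ici 0).indicator (g v) (t - s) * κ s)
        (∫ s, (Ici 0).indicator (g w) (t - s) * κ s) ≤ _
      rw [dist_eq_norm, ← integral_sub (hΦint v t) (hΦint w t)]
      refine (norm_integral_le_of_norm_le (hκ.const_mul (L * dist v w))
        (Eventually.of_forall fun s => ?_)).trans ?_
      · rw [← sub_mul, norm_mul, Real.norm_of_nonneg (hκ0 s)]
        exact mul_le_mul_of_nonneg_right (hgL v w _) (hκ0 s)
      · rw [integral_const_mul]
        refine (mul_le_mul_of_nonneg_left hκε.le (by positivity)).trans (le_of_eq ?_)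
        push_cast
        ring
  set v := hΦ.fixedPoint
  have hfix : Φ v = v := hΦ.fixedPoint_isFixedPt
  refine ⟨fun t => Real.exp (l * t) * v t, by fun_prop, fun t ht => ?_⟩
  have h1 : v t = ∫ s, (Ici 0).indicator (g v) (t - s) * κ s := by
    conv_lhs => rw [← hfix]
    rfl
  have h2 : (fun s => (Ici 0).indicator (g v) (t - s) * κ s) = (Ioc 0 t).indicator fun s =>
      Real.exp (-l * t) * (F (Real.exp (l * (t - s)) * v (t - s)) * k s) := by
    funext s
    by_cases hs : s ∈ Ioc 0 t
    · rw [indicator_of_mem hs, hκdef, indicator_of_mem (mem_Ioi.2 hs.1),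
        indicator_of_mem (mem_Ici.2 (sub_nonneg.2 hs.2))]
      have : Real.exp (-l * t) = Real.exp (-l * (t - s)) * Real.exp (-l * s) := by
        rw [← Real.exp_add]; ring_nf
      rw [this]
      ring
    · rw [indicator_of_notMem hs]
      by_cases hs0 : 0 < s
      · rw [indicator_of_notMem, zero_mul]
        exact fun h => hs ⟨hs0, sub_nonneg.1 h⟩
      · rw [hκdef, indicator_of_notMem (mt mem_Ioi.1 hs0), mul_zero]
  rw [h2, integral_indicator measurableSet_Ioc, integral_const_mul,
    ← intervalIntegral.integral_of_le ht] at h1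
  simp only
  rw [h1, ← mul_assoc, ← Real.exp_add, neg_mul, add_neg_cancel, Real.exp_zero, one_mul]

/-- A Volterra solution with nonincreasing kernel stays below a level above which the nonnegative
nonlinearity vanishes. -/
theorem volterra_le_of_eq_zero {k F ψ : ℝ → ℝ} {r : ℝ} (hk : AntitoneOn k (Ioi 0))
    (hki_loc : ∀ T > (0 : ℝ), IntegrableOn k (Ioc 0 T)) (hr : 0 ≤ r) (hFc : Continuous F)
    (hF0 : ∀ x, 0 ≤ F x) (hFr : ∀ x ≥ r, F x = 0) (hψ : Continuous ψ)
    (hψe : ∀ t ≥ (0 : ℝ), ψ t = ∫ s in (0 : ℝ)..t, F (ψ (t - s)) * k s) :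
    ∀ t ≥ (0 : ℝ), ψ t ≤ r := by
  have hψe' : ∀ t ≥ (0 : ℝ), ψ t = ∫ s in (0 : ℝ)..t, F (ψ s) * k (t - s) := fun t ht => by
    rw [hψe t ht]
    simpa using intervalIntegral.integral_comp_sub_left (a := 0) (b := t)
      (fun s => F (ψ s) * k (t - s)) t
  have hki : ∀ t ≥ (0 : ℝ), IntervalIntegrable (fun s => k (t - s)) volume 0 t := fun t ht => by
    simpa using ((intervalIntegrable_of_integrableOn_Ioc hki_loc ht).comp_sub_left t).symm
  intro T hT
  by_contra! hTr
  have h0 : ψ 0 ≤ r := by simpa [hψe 0 le_rfl] using hr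
  obtain ⟨t, ⟨ht, htr⟩, htmax⟩ := (isCompact_Icc.inter_right
    (isClosed_le hψ continuous_const)).exists_isGreatest
      (s := Icc 0 T ∩ {x | ψ x ≤ r}) ⟨0, left_mem_Icc.2 hT, h0⟩
  have htr : ψ t ≤ r := htr
  have hgt : ∀ s ∈ Ioc t T, F (ψ s) = 0 := fun s hs => by
    refine hFr _ (le_of_not_ge fun h => ?_)
    exact (htmax ⟨⟨ht.1.trans hs.1.le, hs.2⟩, h⟩).not_gt hs.1
  have hiT : IntervalIntegrable (fun s => F (ψ s) * k (T - s)) volume 0 T :=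
    (hki T hT).continuousOn_mul (hFc.comp hψ).continuousOn
  have hsplit := intervalIntegral.integral_add_adjacent_intervals
    (hiT.mono_set (uIcc_subset_uIcc left_mem_uIcc (by rwa [uIcc_of_le hT])))
    (hiT.mono_set (uIcc_subset_uIcc (by rwa [uIcc_of_le hT]) right_mem_uIcc) :
      IntervalIntegrable _ volume t T)
  have hzero : ∫ s in t..T, F (ψ s) * k (T - s) = 0 := by
    rw [intervalIntegral.integral_of_le ht.2]
    refine setIntegral_eq_zero_of_forall_eq_zero fun s hs => ?_
    rw [hgt s hs, zero_mul]
  have hle : ∫ s in (0 : ℝ)..t, F (ψ s) * k (T - s) ≤ ∫ s in (0 : ℝ)..t, F (ψ s) * k (t - s) := by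
    refine intervalIntegral.integral_mono_on_of_le_Ioo ht.1
      (hiT.mono_set (uIcc_subset_uIcc left_mem_uIcc (by rwa [uIcc_of_le hT])))
      ((hki t ht.1).continuousOn_mul (hFc.comp hψ).continuousOn) fun s hs => ?_
    exact mul_le_mul_of_nonneg_left (hk (sub_pos.2 hs.2) (sub_pos.2 (hs.2.trans_le ht.2))
      (by linarith [ht.2])) (hF0 _)
  rw [hzero, add_zero, ← hψe' T hT] at hsplit
  rw [← hψe' t ht.1] at hle
  linarith

theorem riccati_volterra_exists {k : ℝ → ℝ} (hk0 : ∀ t > 0, 0 ≤ k t) (hk : AntitoneOn k (Ioi 0))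
    (hki_loc : ∀ T > (0 : ℝ), IntegrableOn k (Ioc 0 T)) {a b c : ℝ} (ha : 0 ≤ a) (hb : b < 0)
    (hc : 0 ≤ c) (h : 0 < b ^ 2 - 4 * a * c) :
    ∃ ψ : ℝ → ℝ, Continuous ψ ∧
      ∀ t ≥ (0 : ℝ), ψ t = ∫ s in (0 : ℝ)..t, (a + b * ψ (t - s) + c * ψ (t - s) ^ 2) * k s := by
  obtain ⟨r, hr0, hr, hpos⟩ := quad_root ha hb hc h
  set q : ℝ → ℝ := fun x => a + b * x + c * x ^ 2
  have hqc : Continuous q := by fun_prop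
  set F : ℝ → ℝ := IccExtend hr0 ((Icc 0 r).domRestrict q) with hF
  have hFq : ∀ x ∈ Icc 0 r, F x = q x := fun x hx => by
    rw [hF, IccExtend_of_mem _ _ hx]; rfl
  obtain ⟨L, hL⟩ := ((ContDiff.locallyLipschitz (𝕂 := ℝ) (f := q)
    (by fun_prop)).locallyLipschitzOn (s := Icc 0 r)).exists_lipschitzOnWith_of_compact isCompact_Icc
  have hFL : LipschitzWith (L * 1) F := hL.to_restrict.comp (LipschitzWith.projIcc hr0)
  have hF0 : ∀ x, 0 ≤ F x := fun x => hpos _ (projIcc 0 r hr0 x).2.2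
  obtain ⟨B, hB⟩ := isCompact_Icc.exists_bound_of_continuousOn (s := Icc 0 r) hqc.continuousOn
  obtain ⟨ψ, hψ, hψe⟩ := volterra_exists hk0 hk hki_loc hFL (B := B)
    fun x => hB _ (projIcc 0 r hr0 x).2
  have hle := volterra_le_of_eq_zero hk hki_loc hr0 hFL.continuous hF0 (fun x hx => by
    rw [hF, IccExtend_of_right_le _ _ hx]; exact hr) hψ hψe
  have hge : ∀ t ≥ (0 : ℝ), 0 ≤ ψ t := fun t ht => by
    rw [hψe t ht, intervalIntegral.integral_of_le ht]
    exact setIntegral_nonneg measurableSet_Ioc fun s hs => mul_nonneg (hF0 _) (hk0 s hs.1)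
  refine ⟨ψ, hψ, fun t ht => (hψe t ht).trans ?_⟩
  refine intervalIntegral.integral_congr fun s hs => ?_
  rw [uIcc_of_le ht] at hs
  have hts := sub_nonneg.2 hs.2
  rw [hFq _ ⟨hge _ hts, hle _ hts⟩]

theorem integrableOn_Ioc_of_sq {k : ℝ → ℝ} (hk : AntitoneOn k (Ioi 0))
    (h2 : ∀ T > (0 : ℝ), IntegrableOn (fun t => k t ^ 2) (Icc 0 T)) :
    ∀ T > (0 : ℝ), IntegrableOn k (Ioc 0 T) := by
  intro T hT
  have hm : AEStronglyMeasurable k (volume.restrict (Ioc 0 T)) :=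
    ((aemeasurable_restrict_of_antitoneOn measurableSet_Ioi hk).aestronglyMeasurable).mono_measure
      (Measure.restrict_mono Ioc_subset_Ioi_self le_rfl)
  exact ((memLp_two_iff_integrable_sq hm).2 ((h2 T hT).mono_set Ioc_subset_Icc_self)).integrable
    one_le_two

theorem antitoneOn_Ioi_of_iteratedDerivWithin {k : ℝ → ℝ} (hs : ContDiffOn ℝ 1 k (Ioi 0))
    (h1 : ∀ t > (0 : ℝ), 0 ≤ (-1 : ℝ) ^ 1 * iteratedDerivWithin 1 k (Ioi 0) t) :
    AntitoneOn k (Ioi 0) := by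
  refine antitoneOn_of_deriv_nonpos (convex_Ioi 0) hs.continuousOn ?_ fun t ht => ?_
  · rw [interior_Ioi]; exact hs.differentiableOn one_ne_zero
  · rw [interior_Ioi] at ht
    have := h1 t ht
    rw [iteratedDerivWithin_one, derivWithin_of_isOpen isOpen_Ioi ht] at this
    linarith

theorem intervalIntegral_matrix_apply {m n : Type*} [Fintype m] [Fintype n]
    {f : ℝ → Matrix m n ℝ} {a b : ℝ} (hf : ∀ i j, IntervalIntegrable (fun s => f s i j) volume a b)
    (i : m) (j : n) : (∫ s in a..b, f s) i j = ∫ s in a..b, f s i j := by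
  have h : IntervalIntegrable (ε := m → n → ℝ) f volume a b :=
    ⟨Integrable.of_eval fun i => Integrable.of_eval fun j => (hf i j).1,
      Integrable.of_eval fun i => Integrable.of_eval fun j => (hf i j).2⟩
  exact ((.proj j ∘L .proj i : (m → n → ℝ) →L[ℝ] ℝ).intervalIntegral_comp_comm h).symm

end

/-- If each K_i is completely monotone on (0,∞) and locally square-integrable,
and for every i we have δ_i + (γ/(1−γ))ν_iρ_iθ_i < 0 and
(δ_i + (γ/(1−γ))ν_iρ_iθ_i)² − (γ/(1−γ))((1−γ+γρ_i²)/(1−γ))ν_i²θ_i² > 0, then the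
Riccati–Volterra equation ψ(t) = ∫₀ᵗ F₂(ψ(t−s))K(s)ds has a unique continuous global
solution on [0,∞). -/
theorem stmt_4 (d : ℕ) (hd : 1 ≤ d) (γ : ℝ) (hγ : γ ∈ Set.Ioo (0 : ℝ) 1)
    (θ ν ρ δ : Fin d → ℝ)
    (hθ : ∀ i, 0 ≤ θ i) (hρ : ∀ i, ρ i ∈ Set.Icc (-1 : ℝ) 1)
    (Kf : Fin d → ℝ → ℝ)
    (hKsmooth : ∀ i, ContDiffOn ℝ (⊤ : ℕ∞) (Kf i) (Set.Ioi 0))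
    (hKcm : ∀ i, ∀ n : ℕ, ∀ t > (0 : ℝ),
      0 ≤ (-1 : ℝ) ^ n * iteratedDerivWithin n (Kf i) (Set.Ioi 0) t)
    (hKL2 : ∀ i, ∀ T > (0 : ℝ), IntegrableOn (fun t => (Kf i t) ^ 2) (Set.Icc 0 T))
    (hneg : ∀ i, δ i + γ / (1 - γ) * ν i * ρ i * θ i < 0)
    (hpos : ∀ i, 0 < (δ i + γ / (1 - γ) * ν i * ρ i * θ i) ^ 2
      - γ / (1 - γ) * ((1 - γ + γ * (ρ i) ^ 2) / (1 - γ)) * (ν i) ^ 2 * (θ i) ^ 2)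
    (θrow : Matrix (Fin 1) (Fin d) ℝ) (hθrow : θrow = Matrix.of fun _ i => θ i)
    (N Θ P D Λ : Matrix (Fin d) (Fin d) ℝ)
    (hN : N = Matrix.diagonal ν) (hΘ : Θ = Matrix.diagonal θ)
    (hP : P = Matrix.diagonal ρ) (hD : D = Matrix.diagonal δ)
    (hΛ : Λ = D + (γ / (1 - γ)) • (N * P * Θ))
    (F₂ : Matrix (Fin 1) (Fin d) ℝ → Matrix (Fin 1) (Fin d) ℝ)
    (hF₂ : ∀ ψ : Matrix (Fin 1) (Fin d) ℝ,
      F₂ ψ = (γ / (2 * (1 - γ))) • (θrow * Θ) + ψ * Λ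
        + (1 / 2 : ℝ) • ((ψ * N ^ 2 * Matrix.diagonal fun i => ψ 0 i)
          + (γ / (1 - γ)) • (ψ * N ^ 2 * P ^ 2 * Matrix.diagonal fun i => ψ 0 i)))
    (K : ℝ → Matrix (Fin d) (Fin d) ℝ)
    (hK : ∀ s, K s = Matrix.diagonal fun i => Kf i s) :
    ∃ ψ : ℝ → Matrix (Fin 1) (Fin d) ℝ,
      (ContinuousOn ψ (Set.Ici 0) ∧
        ∀ t ≥ (0 : ℝ), ψ t = ∫ s in (0 : ℝ)..t, F₂ (ψ (t - s)) * K s) ∧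
      ∀ ψ' : ℝ → Matrix (Fin 1) (Fin d) ℝ,
        ContinuousOn ψ' (Set.Ici 0) →
        (∀ t ≥ (0 : ℝ), ψ' t = ∫ s in (0 : ℝ)..t, F₂ (ψ' (t - s)) * K s) →
        ∀ t ≥ (0 : ℝ), ψ' t = ψ t := by
  obtain ⟨hγ0, hγ1⟩ := hγ
  have h1γ : 0 < 1 - γ := sub_pos.2 hγ1
  have hk0 : ∀ i, ∀ t > (0 : ℝ), 0 ≤ Kf i t := fun i t ht => by simpa using hKcm i 0 t ht
  have hk : ∀ i, AntitoneOn (Kf i) (Set.Ioi 0) := fun i =>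
    antitoneOn_Ioi_of_iteratedDerivWithin ((hKsmooth i).of_le (by exact_mod_cast le_top))
      (hKcm i 1)
  have hki_loc := fun i => integrableOn_Ioc_of_sq (hk i) (hKL2 i)
  set a : Fin d → ℝ := fun i => γ / (2 * (1 - γ)) * θ i ^ 2 with ha
  set b : Fin d → ℝ := fun i => δ i + γ / (1 - γ) * ν i * ρ i * θ i with hb
  set c : Fin d → ℝ := fun i => 1 / 2 * (ν i ^ 2 * (1 + γ / (1 - γ) * ρ i ^ 2)) with hc
  have hentry : ∀ (φ : Matrix (Fin 1) (Fin d) ℝ) s j i,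
      (F₂ φ * K s) j i = (a i + b i * φ 0 i + c i * φ 0 i ^ 2) * Kf i s := by
    intro φ s j i
    rw [Subsingleton.elim j 0, hF₂, hK, hθrow, hΛ, hD, hN, hP, hΘ, Matrix.mul_diagonal]
    simp only [Matrix.diagonal_pow, Matrix.diagonal_mul_diagonal, Matrix.add_apply,
      Matrix.smul_apply, Matrix.mul_diagonal, Matrix.mul_add, Matrix.mul_smul, Matrix.of_apply,
      smul_eq_mul, Pi.pow_apply, ha, hb, hc]
    ring
  have hquad : ∀ i, LocallyLipschitz fun x : ℝ => a i + b i * x + c i * x ^ 2 := fun i =>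
    ContDiff.locallyLipschitz (𝕂 := ℝ) (by fun_prop)
  have hcomp : ∀ φ : ℝ → Matrix (Fin 1) (Fin d) ℝ, (∀ i, ContinuousOn (φ · 0 i) (Set.Ici 0)) →
      ∀ t ≥ (0 : ℝ), ∀ i, (∫ s in (0 : ℝ)..t, F₂ (φ (t - s)) * K s) 0 i =
        ∫ s in (0 : ℝ)..t, (a i + b i * φ (t - s) 0 i + c i * φ (t - s) 0 i ^ 2) * Kf i s := by
    intro φ hφ t ht i
    rw [intervalIntegral_matrix_apply]
    · simp only [hentry]
    · intro j i
      simp only [hentry]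
      exact (intervalIntegrable_of_integrableOn_Ioc (hki_loc i) ht).convolution_integrand ht
        ((hquad i).continuous.comp_continuousOn (hφ i))
  have hex := fun i => riccati_volterra_exists (hk0 i) (hk i) (hki_loc i) (a := a i) (b := b i)
    (c := c i) (by positivity) (hneg i) (by positivity) (by
      have : 4 * a i * c i = γ / (1 - γ) * ((1 - γ + γ * (ρ i) ^ 2) / (1 - γ)) * (ν i) ^ 2
          * (θ i) ^ 2 := by
        simp only [ha, hc]
        field_simp
        ring
      rw [this]
      exact hpos i)
  choose x hxc hxe using hex
  refine ⟨fun t => Matrix.of fun _ i => x i t, ⟨?_, fun t ht => ?_⟩, fun ψ' hψ' hψe t ht => ?_⟩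
  · exact (continuous_matrix fun _ i => hxc i).continuousOn
  · ext j i
    rw [Subsingleton.elim j 0]
    exact (hxe i t ht).trans (hcomp (fun t => Matrix.of fun _ i => x i t)
      (fun i => (hxc i).continuousOn) t ht i).symm
  · have hψi : ∀ i, ContinuousOn (ψ' · 0 i) (Set.Ici 0) := fun i =>
      (continuous_id.matrix_elem 0 i).comp_continuousOn hψ'
    ext j i
    rw [Subsingleton.elim j 0]
    exact volterra_unique (hk0 i) (hk i) (hki_loc i) (hquad i) (hψi i) (hxc i).continuousOn
      (fun t ht => by rw [← hcomp ψ' hψi t ht i, ← hψe t ht]) (hxe i) t ht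
end

section
/- Let H ∈ (0, 1/2] and define the fractional kernel K(t) = t^{H−1/2}/Γ(H+1/2) for t > 0. Then for every T > 0 there exists k > 0 such that for all h > 0: ∫₀ʰ K(t)² dt + ∫₀ᵀ (K(t+h) − K(t))² dt ≤ k·h^{2H}. -/
/-- The fractional kernel K(t) = t^{H−1/2}/Γ(H+1/2), H ∈ (0,1/2], satisfies
∫₀ʰ K(t)²dt + ∫₀ᵀ (K(t+h)−K(t))²dt ≤ k·h^{2H} for all h > 0, for some k > 0. -/
theorem stmt_15 (H : ℝ) (hH : H ∈ Set.Ioc (0 : ℝ) (1 / 2))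
    (K : ℝ → ℝ) (hK : ∀ t > (0 : ℝ), K t = t ^ (H - 1 / 2) / Real.Gamma (H + 1 / 2)) :
    ∀ T > (0 : ℝ), ∃ k > (0 : ℝ), ∀ h > (0 : ℝ),
      (∫ t in (0 : ℝ)..h, (K t) ^ 2) + (∫ t in (0 : ℝ)..T, (K (t + h) - K t) ^ 2)
        ≤ k * h ^ (2 * H) := by
  obtain ⟨hH0, hH1⟩ := hH
  intro T hT
  set G := Real.Gamma (H + 1 / 2)
  have hG : 0 < G := Real.Gamma_pos_of_pos (by linarith)
  refine ⟨1 / (G ^ 2 * H), by positivity, fun h hh => ?_⟩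
  have hexp : (-1 : ℝ) < 2 * H - 1 := by linarith
  have hKsq : ∀ t > (0 : ℝ), K t ^ 2 = t ^ (2 * H - 1) / G ^ 2 := fun t ht => by
    rw [hK t ht, div_pow, ← Real.rpow_mul_natCast ht.le]
    congr 2
    push_cast
    ring
  have hint : ∀ a b : ℝ, ∫ t in a..b, t ^ (2 * H - 1) =
      (b ^ (2 * H) - a ^ (2 * H)) / (2 * H) := fun a b => by
    rw [integral_rpow (Or.inl hexp), sub_add_cancel]
  have hz : (0 : ℝ) ^ (2 * H) = 0 := Real.zero_rpow (by positivity)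
  have hfirst : ∫ t in (0 : ℝ)..h, K t ^ 2 = h ^ (2 * H) / (2 * H) / G ^ 2 := by
    rw [intervalIntegral.integral_congr_uIoo (g := fun t => t ^ (2 * H - 1) / G ^ 2),
      intervalIntegral.integral_div, hint, hz, sub_zero]
    intro t ht
    rw [Set.uIoo_of_le hh.le] at ht
    exact hKsq t ht.1
  have hi : IntervalIntegrable (fun t : ℝ => t ^ (2 * H - 1)) MeasureTheory.volume 0 T :=
    intervalIntegral.intervalIntegrable_rpow' hexp
  have hi' : IntervalIntegrable (fun t : ℝ => (t + h) ^ (2 * H - 1)) MeasureTheory.volume 0 T := by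
    simpa using (intervalIntegral.intervalIntegrable_rpow' hexp
      (a := 0 + h) (b := T + h)).comp_add_right h
  have hdiff := (hi.sub hi').div_const (G ^ 2)
  have hsecond : ∫ t in (0 : ℝ)..T, (K (t + h) - K t) ^ 2 ≤ h ^ (2 * H) / (2 * H) / G ^ 2 := by
    calc ∫ t in (0 : ℝ)..T, (K (t + h) - K t) ^ 2
        ≤ ∫ t in (0 : ℝ)..T, (t ^ (2 * H - 1) - (t + h) ^ (2 * H - 1)) / G ^ 2 := by
          rw [intervalIntegral.integral_of_le hT.le, intervalIntegral.integral_of_le hT.le]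
          refine MeasureTheory.integral_mono_of_nonneg (.of_forall fun _ => sq_nonneg _)
            hdiff.1 ?_
          filter_upwards [MeasureTheory.ae_restrict_mem measurableSet_Ioc] with t ht
          have ht0 : 0 < t := ht.1
          have hth : 0 < t + h := by positivity
          have hle : K (t + h) ≤ K t := by
            rw [hK t ht0, hK _ hth]
            exact div_le_div_of_nonneg_right
              (Real.rpow_le_rpow_of_nonpos ht0 (by linarith) (by linarith)) hG.le
          have h0 : 0 ≤ K (t + h) := by
            rw [hK _ hth]
            positivity
          rw [sub_div, ← hKsq t ht0, ← hKsq _ hth]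
          nlinarith
      _ = (T ^ (2 * H) - (T + h) ^ (2 * H) + h ^ (2 * H)) / (2 * H) / G ^ 2 := by
          rw [intervalIntegral.integral_div, intervalIntegral.integral_sub hi hi',
            intervalIntegral.integral_comp_add_right (fun t : ℝ => t ^ (2 * H - 1)), hint, hint,
            hz, zero_add]
          ring
      _ ≤ h ^ (2 * H) / (2 * H) / G ^ 2 := by
          have : T ^ (2 * H) ≤ (T + h) ^ (2 * H) :=
            Real.rpow_le_rpow hT.le (by linarith) (by positivity)
          gcongr
          linarith
  calc _ ≤ h ^ (2 * H) / (2 * H) / G ^ 2 + h ^ (2 * H) / (2 * H) / G ^ 2 := by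
        rw [hfirst]
        gcongr
    _ = 1 / (G ^ 2 * H) * h ^ (2 * H) := by
        field_simp
        ring
end
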